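/- arXiv:2407.20415 — 7 statements merged into one kernel-verified Lean document; each statement's English description precedes it below -/
import Mathlib

section
/- Let X and Y be real Banach spaces, K a closed subspace of X, and D : X → Y a continuous linear map such that ‖u‖ ≤ C_D·‖D u‖ for all u ∈ K, for a constant C_D > 0. Let y₀ ∈ Y and let Q : X → Y satisfy a quadratic estimate with constant C_Q > 0 on the ball of radius R > 0. If u, v ∈ K satisfy ‖u‖ ≤ R, ‖v‖ ≤ R, y₀ + D u + Q(u) = 0, y₀ + D v + Q(v) = 0, and C_D·C_Q·(‖u‖ + ‖v‖) < 1, then u = v. -/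
/-- Uniqueness part of the abstract iteration scheme: two small solutions
in `K` of `y₀ + D v + Q v = 0` coincide, provided `C_D * C_Q * (‖u‖ + ‖v‖) < 1`. -/
theorem stmt_1
    {X Y : Type*} [NormedAddCommGroup X] [NormedSpace ℝ X] [CompleteSpace X]
    [NormedAddCommGroup Y] [NormedSpace ℝ Y] [CompleteSpace Y]
    (K : Subspace ℝ X) (hKclosed : IsClosed (K : Set X))
    (D : X →L[ℝ] Y)
    (C_D : ℝ) (hCD : 0 < C_D)
    (hbound : ∀ u ∈ K, ‖u‖ ≤ C_D * ‖D u‖)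
    (y₀ : Y) (Q : X → Y) (C_Q R : ℝ) (hCQ : 0 < C_Q) (hR : 0 < R)
    (hQ0 : Q 0 = 0)
    (hQ : ∀ u v : X, ‖u‖ ≤ R → ‖v‖ ≤ R →
      ‖Q u - Q v‖ ≤ C_Q * ‖u - v‖ * (‖u‖ + ‖v‖))
    (u v : X) (hu : u ∈ K) (hv : v ∈ K)
    (huR : ‖u‖ ≤ R) (hvR : ‖v‖ ≤ R)
    (hue : y₀ + D u + Q u = 0) (hve : y₀ + D v + Q v = 0)
    (hsmall : C_D * C_Q * (‖u‖ + ‖v‖) < 1) :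
    u = v := by
  have hD : D (u - v) = -(Q u - Q v) := by
    rw [map_sub, ← sub_eq_zero]
    calc D u - D v - -(Q u - Q v) = (y₀ + D u + Q u) - (y₀ + D v + Q v) := by abel
      _ = 0 := by rw [hue, hve, sub_zero]
  have hle : ‖u - v‖ ≤ C_D * C_Q * (‖u‖ + ‖v‖) * ‖u - v‖ :=
    calc ‖u - v‖ ≤ C_D * ‖D (u - v)‖ := hbound _ (K.sub_mem hu hv)
      _ = C_D * ‖Q u - Q v‖ := by rw [hD, norm_neg]
      _ ≤ C_D * (C_Q * ‖u - v‖ * (‖u‖ + ‖v‖)) :=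
        mul_le_mul_of_nonneg_left (hQ u v huR hvR) hCD.le
      _ = C_D * C_Q * (‖u‖ + ‖v‖) * ‖u - v‖ := by ring
  by_contra hne
  have hpos : 0 < ‖u - v‖ := norm_pos_iff.mpr (sub_ne_zero.mpr hne)
  exact absurd hle (not_le.mpr (mul_lt_of_lt_one_left hpos hsmall))
end

section
/- Let P, X and Y be real Banach spaces, e : X → Y a continuous linear equivalence whose inverse has operator norm at most C_D, y : P → Y an infinitely differentiable map, and Q : P × X → Y an infinitely differentiable map such that for every p ∈ P the map Q(p, ·) satisfies a quadratic estimate with constant C_Q on all of X. Suppose there is m ≥ 0 with ‖y(p)‖ ≤ m for all p and 4·C_D²·C_Q·m < 1. Then there is an infinitely differentiable map v : P → X such that for every p ∈ P one has y(p) + e(v(p)) + Q(p, v(p)) = 0 and ‖v(p)‖ ≤ 2·C_D·‖y(p)‖. -/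
open Filter Asymptotics in
/-- A continuous solution `v` of `F (p, v p) = 0` is differentiable wherever the partial derivative
of `F` in the second variable is invertible. Unlike in the implicit function theorem, no
completeness is needed. -/
theorem hasFDerivAt_of_implicit_eq
    {P X Y : Type*} [NormedAddCommGroup P] [NormedSpace ℝ P]
    [NormedAddCommGroup X] [NormedSpace ℝ X] [NormedAddCommGroup Y] [NormedSpace ℝ Y]
    {F : P × X → Y} {F' : P × X →L[ℝ] Y} {v : P → X} {p : P}
    (hF : HasFDerivAt F F' (p, v p)) (hv : ContinuousAt v p) (h0 : ∀ q, F (q, v q) = 0)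
    (hinv : (F' ∘L .inr ℝ P X).IsInvertible) :
    HasFDerivAt v (-(F' ∘L .inr ℝ P X).inverse ∘L (F' ∘L .inl ℝ P X)) p := by
  set B := F' ∘L .inr ℝ P X with hB
  set A := F' ∘L .inl ℝ P X with hA
  have hlim : Tendsto (fun q => (q, v q)) (nhds p) (nhds (p, v p)) := continuousAt_id.prodMk hv
  have hΔ : (fun q => F' ((q, v q) - (p, v p))) =o[nhds p] fun q => (q, v q) - (p, v p) := by
    refine (hF.isLittleO.comp_tendsto hlim).neg_left.congr_left fun q => ?_
    simp only [Function.comp_apply, h0, sub_self, zero_sub, neg_neg]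
  have hF' : ∀ q, B.inverse (F' ((q, v q) - (p, v p))) =
      v q - v p - (-B.inverse ∘L A) (q - p) := by
    intro q
    have : F' ((q, v q) - (p, v p)) = A (q - p) + B (v q - v p) := by
      simp [hA, hB, ← map_add]
    rw [this, map_add, hinv.inverse_apply_self]
    simp only [neg_apply, ContinuousLinearMap.comp_apply]
    abel
  have hw : (fun q => v q - v p - (-B.inverse ∘L A) (q - p)) =o[nhds p]
      fun q => (q, v q) - (p, v p) := by
    simpa only [hF'] using (B.inverse.isBigO_comp _ _).trans_isLittleO hΔ
  have hw' : (fun q => ((0 : P), v q - v p - (-B.inverse ∘L A) (q - p))) =o[nhds p]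
      fun q => (q, v q) - (p, v p) :=
    (isLittleO_zero _ _).prod_left hw
  refine HasFDerivAt.of_isLittleO (hw.trans_isBigO (hw'.right_isBigO_sub.trans ?_))
  refine ((ContinuousLinearMap.prod (.id ℝ P) (-B.inverse ∘L A)).isBigO_comp
    (fun q => q - p) (nhds p)).congr_left fun q => ?_
  simp

/-- A continuous solution `v` of a smooth equation `F (p, v p) = 0` is smooth if the partial
derivative of `F` in the second variable is invertible along the solution. -/
theorem contDiff_of_implicit_eq
    {P X Y : Type*} [NormedAddCommGroup P] [NormedSpace ℝ P]
    [NormedAddCommGroup X] [NormedSpace ℝ X] [CompleteSpace X]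
    [NormedAddCommGroup Y] [NormedSpace ℝ Y]
    {F : P × X → Y} {v : P → X} (hF : ContDiff ℝ (⊤ : ℕ∞) F) (hv : Continuous v)
    (h0 : ∀ p, F (p, v p) = 0)
    (hinv : ∀ p, (fderiv ℝ F (p, v p) ∘L .inr ℝ P X).IsInvertible) :
    ContDiff ℝ (⊤ : ℕ∞) v := by
  have hder p := hasFDerivAt_of_implicit_eq
    ((hF.differentiable (by simp)) (p, v p)).hasFDerivAt hv.continuousAt h0 (hinv p)
  refine contDiff_infty.2 fun n => ?_
  induction n with
  | zero => exact contDiff_zero.2 hv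
  | succ n ih =>
    refine contDiff_succ_iff_hasFDerivAt.2 ⟨_, ?_, hder⟩
    have hD : ContDiff ℝ n fun p => fderiv ℝ F (p, v p) :=
      (hF.fderiv_right (m := n) (by exact_mod_cast le_top)).comp (contDiff_id.prodMk ih)
    have hI : ContDiff ℝ n fun p => (fderiv ℝ F (p, v p) ∘L .inr ℝ P X).inverse :=
      contDiff_iff_contDiffAt.2 fun p =>
        ContDiffAt.comp (g := ContinuousLinearMap.inverse) p (hinv p).contDiffAt_map_inverse
          (hD.clm_comp contDiff_const).contDiffAt
    exact hI.neg.clm_comp (hD.clm_comp contDiff_const)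

theorem ContinuousLinearEquiv.isInvertible_add_of_norm_symm_mul_norm_lt_one
    {X Y : Type*} [NormedAddCommGroup X] [NormedSpace ℝ X] [CompleteSpace X]
    [NormedAddCommGroup Y] [NormedSpace ℝ Y] (e : X ≃L[ℝ] Y) {D : X →L[ℝ] Y}
    (h : ‖(e.symm : Y →L[ℝ] X)‖ * ‖D‖ < 1) : ((e : X →L[ℝ] Y) + D).IsInvertible := by
  have hlt : ‖-((e.symm : Y →L[ℝ] X) ∘L D)‖ < 1 := by
    rw [norm_neg]
    exact (ContinuousLinearMap.opNorm_comp_le _ _).trans_lt h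
  refine ⟨(ContinuousLinearEquiv.unitsEquiv ℝ X (Units.oneSub _ hlt)).trans e, ?_⟩
  ext x
  simp [ContinuousLinearEquiv.unitsEquiv_apply]

/-- The derivative at `u` of a map satisfying a quadratic estimate with constant `C` has norm at
most `2 * C * ‖u‖`. -/
theorem HasFDerivAt.norm_le_of_quadratic_estimate
    {X Y : Type*} [NormedAddCommGroup X] [NormedSpace ℝ X]
    [NormedAddCommGroup Y] [NormedSpace ℝ Y] {q : X → Y} {D : X →L[ℝ] Y} {u : X} {C : ℝ}
    (hC : 0 ≤ C) (hq : ∀ u v, ‖q u - q v‖ ≤ C * ‖u - v‖ * (‖u‖ + ‖v‖)) (hD : HasFDerivAt q D u) :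
    ‖D‖ ≤ 2 * C * ‖u‖ := by
  have key : ∀ r > ‖u‖, ‖D‖ ≤ C * (r + ‖u‖) := by
    intro r hr
    have hr0 := (norm_nonneg u).trans hr.le
    refine hD.le_of_lip' (by positivity) ?_
    filter_upwards [continuous_norm.continuousAt.eventually_lt continuousAt_const hr] with x hx
    calc ‖q x - q u‖ ≤ C * ‖x - u‖ * (‖x‖ + ‖u‖) := hq x u
      _ ≤ C * ‖x - u‖ * (r + ‖u‖) := by gcongr
      _ = C * (r + ‖u‖) * ‖x - u‖ := by ring
  have hlim : Filter.Tendsto (fun r => C * (r + ‖u‖)) (nhdsWithin ‖u‖ (Set.Ioi ‖u‖))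
      (nhds (C * (‖u‖ + ‖u‖))) :=
    (Continuous.tendsto (by fun_prop) _).mono_left nhdsWithin_le_nhds
  have := ge_of_tendsto hlim (Filter.eventually_of_mem self_mem_nhdsWithin key)
  linarith

/-- A constant in a quadratic estimate can be replaced by its positive part. -/
theorem quadratic_estimate_max_zero
    {X Y : Type*} [NormedAddCommGroup X] [NormedAddCommGroup Y] {q : X → Y} {C : ℝ} {u v : X}
    (hq : ‖q u - q v‖ ≤ C * ‖u - v‖ * (‖u‖ + ‖v‖)) :
    ‖q u - q v‖ ≤ max C 0 * ‖u - v‖ * (‖u‖ + ‖v‖) :=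
  hq.trans (by gcongr; exact le_max_left _ _)

/-- Solvability of `b + e x + q x = 0` for a quadratic perturbation `q` of an isomorphism `e`. -/
theorem exists_small_solution_of_quadratic_estimate
    {X Y : Type*} [NormedAddCommGroup X] [NormedSpace ℝ X] [CompleteSpace X]
    [NormedAddCommGroup Y] [NormedSpace ℝ Y] (e : X ≃L[ℝ] Y) {K C : ℝ} (hC : 0 ≤ C)
    (he : ‖(e.symm : Y →L[ℝ] X)‖ ≤ K) {q : X → Y} (hq0 : q 0 = 0)
    (hq : ∀ u v, ‖q u - q v‖ ≤ C * ‖u - v‖ * (‖u‖ + ‖v‖)) (b : Y)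
    (hb : 4 * K ^ 2 * C * ‖b‖ < 1) :
    ∃ x, b + e x + q x = 0 ∧ ‖x‖ ≤ 2 * K * ‖b‖ := by
  have hK : 0 ≤ K := (norm_nonneg _).trans he
  have hsymm : ∀ z, ‖e.symm z‖ ≤ K * ‖z‖ := (e.symm : Y →L[ℝ] X).le_of_opNorm_le he
  set T : X → X := fun x => -e.symm (b + q x)
  set s := Metric.closedBall (0 : X) (2 * K * ‖b‖)
  have hmaps : Set.MapsTo T s s := by
    intro x hx
    rw [mem_closedBall_zero_iff] at hx ⊢
    have hqx : ‖q x‖ ≤ C * (2 * K * ‖b‖) * (2 * K * ‖b‖) := by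
      calc ‖q x‖ ≤ C * ‖x‖ * ‖x‖ := by simpa [hq0] using hq x 0
        _ ≤ _ := by gcongr
    have : C * (2 * K * ‖b‖) * (2 * K * ‖b‖) ≤ ‖b‖ := by
      nlinarith [mul_le_mul_of_nonneg_right hb.le (norm_nonneg b)]
    calc ‖T x‖ ≤ K * ‖b + q x‖ := by simpa only [T, norm_neg] using hsymm _
      _ ≤ K * (‖b‖ + ‖b‖) := by gcongr; exact norm_add_le_of_le le_rfl (hqx.trans this)
      _ = 2 * K * ‖b‖ := by ring
  have hcontr : ContractingWith ⟨4 * K ^ 2 * C * ‖b‖, by positivity⟩ (hmaps.restrict T s s) := by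
    refine ⟨hb, LipschitzWith.of_dist_le_mul fun x z => ?_⟩
    have hx := mem_closedBall_zero_iff.1 x.2
    have hz := mem_closedBall_zero_iff.1 z.2
    have hT : T x - T z = e.symm (q z - q x) := by simp [T]; abel
    rw [Subtype.dist_eq, Subtype.dist_eq, Set.MapsTo.val_restrict_apply,
      Set.MapsTo.val_restrict_apply, dist_eq_norm, dist_eq_norm, hT]
    calc ‖e.symm (q z - q x)‖ ≤ K * ‖q z - q x‖ := hsymm _
      _ = K * ‖q x - q z‖ := by rw [norm_sub_rev]
      _ ≤ K * (C * ‖(x : X) - z‖ * (2 * K * ‖b‖ + 2 * K * ‖b‖)) := by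
        gcongr
        exact (hq x z).trans (by gcongr)
      _ = 4 * K ^ 2 * C * ‖b‖ * ‖(x : X) - z‖ := by ring
  obtain ⟨x, hxs, hx, -⟩ := hcontr.exists_fixedPoint' Metric.isClosed_closedBall.isComplete hmaps
    (Metric.mem_closedBall_self (by positivity)) (edist_ne_top 0 _)
  refine ⟨x, ?_, mem_closedBall_zero_iff.1 hxs⟩
  have hex : e x = -(b + q x) := by
    conv_lhs => rw [← hx.eq]
    simp [T]
  rw [hex]
  abel

/-- A uniformly small family of solutions of `y p + e (v p) + Q (p, v p) = 0` is continuous. -/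
theorem continuous_of_quadratic_estimate
    {P X Y : Type*} [TopologicalSpace P] [NormedAddCommGroup X] [NormedSpace ℝ X]
    [NormedAddCommGroup Y] [NormedSpace ℝ Y] (e : X ≃L[ℝ] Y) {K C R : ℝ} (hC : 0 ≤ C)
    (he : ‖(e.symm : Y →L[ℝ] X)‖ ≤ K) {y : P → Y} (hy : Continuous y) {Q : P × X → Y}
    (hQc : Continuous Q)
    (hQ : ∀ p u v, ‖Q (p, u) - Q (p, v)‖ ≤ C * ‖u - v‖ * (‖u‖ + ‖v‖))
    {v : P → X} (hv : ∀ p, y p + e (v p) + Q (p, v p) = 0) (hvR : ∀ p, ‖v p‖ ≤ R)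
    (hR : K * C * (2 * R) < 1) : Continuous v := by
  have hK : 0 ≤ K := (norm_nonneg _).trans he
  refine continuous_iff_continuousAt.2 fun p => ?_
  set δ : P → Y := fun p' => (y p' + Q (p', v p)) - (y p + Q (p, v p))
  have hδ : Filter.Tendsto (fun p' => (1 - K * C * (2 * R))⁻¹ * (K * ‖δ p'‖)) (nhds p)
      (nhds 0) := by
    have : Continuous fun p' => (1 - K * C * (2 * R))⁻¹ * (K * ‖δ p'‖) := by fun_prop
    simpa [δ] using this.tendsto p
  refine tendsto_iff_norm_sub_tendsto_zero.2
    (squeeze_zero (fun _ => norm_nonneg _) (fun p' => ?_) hδ)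
  rw [le_inv_mul_iff₀ (by linarith)]
  have hdiff : v p' - v p = -e.symm (δ p' + (Q (p', v p') - Q (p', v p))) := by
    apply e.injective
    rw [map_neg, e.apply_symm_apply, map_sub, eq_neg_of_add_eq_zero_right
      (show (y p' + Q (p', v p')) + e (v p') = 0 by rw [← hv p']; abel),
      eq_neg_of_add_eq_zero_right (show (y p + Q (p, v p)) + e (v p) = 0 by rw [← hv p]; abel)]
    simp only [δ]
    abel
  have : ‖v p' - v p‖ ≤ K * (‖δ p'‖ + C * ‖v p' - v p‖ * (2 * R)) := by
    conv_lhs => rw [hdiff, norm_neg]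
    refine ((e.symm : Y →L[ℝ] X).le_of_opNorm_le he _).trans ?_
    gcongr
    refine norm_add_le_of_le le_rfl ((hQ _ _ _).trans ?_)
    gcongr
    linarith [hvR p', hvR p]
  linarith


/-- Smooth dependence on parameters of the unique small solution of the
perturbed deformation equation: if `y : P → Y` and `Q : P × X → Y` are smooth, each
`Q (p, ·)` satisfies a global quadratic estimate with constant `C_Q`, `‖y p‖ ≤ m`
uniformly and `4 * C_D ^ 2 * C_Q * m < 1`, then there is a smooth `v : P → X` with
`y p + e (v p) + Q (p, v p) = 0` and `‖v p‖ ≤ 2 * C_D * ‖y p‖` for every `p`. -/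
theorem stmt_3
    {P X Y : Type*} [NormedAddCommGroup P] [NormedSpace ℝ P]
    [NormedAddCommGroup X] [NormedSpace ℝ X] [CompleteSpace X]
    [NormedAddCommGroup Y] [NormedSpace ℝ Y] [CompleteSpace Y]
    (e : X ≃L[ℝ] Y) (C_D C_Q : ℝ)
    (hinv : ‖(e.symm : Y →L[ℝ] X)‖ ≤ C_D)
    (y : P → Y) (hy : ContDiff ℝ (⊤ : ℕ∞) y)
    (Q : P × X → Y) (hQsmooth : ContDiff ℝ (⊤ : ℕ∞) Q)
    (hQ0 : ∀ p : P, Q (p, 0) = 0)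
    (hQ : ∀ p : P, ∀ u v : X,
      ‖Q (p, u) - Q (p, v)‖ ≤ C_Q * ‖u - v‖ * (‖u‖ + ‖v‖))
    (m : ℝ) (hm : 0 ≤ m) (hym : ∀ p : P, ‖y p‖ ≤ m)
    (hsmall : 4 * C_D ^ 2 * C_Q * m < 1) :
    ∃ v : P → X, ContDiff ℝ (⊤ : ℕ∞) v ∧
      ∀ p : P, y p + e (v p) + Q (p, v p) = 0 ∧ ‖v p‖ ≤ 2 * C_D * ‖y p‖ := by
  have hC : 0 ≤ max C_Q 0 := le_max_right _ _
  have hK : 0 ≤ C_D := (norm_nonneg _).trans hinv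
  replace hQ := fun p u v => quadratic_estimate_max_zero (q := fun x => Q (p, x)) (hQ p u v)
  replace hsmall : 4 * C_D ^ 2 * max C_Q 0 * m < 1 := by
    rcases max_cases C_Q 0 with ⟨h, -⟩ | ⟨h, -⟩ <;> simp [h, hsmall]
  generalize max C_Q 0 = C at hC hQ hsmall
  have hsol p := exists_small_solution_of_quadratic_estimate e hC hinv (hQ0 p) (hQ p) (y p)
    (lt_of_le_of_lt (by gcongr; exact hym p) hsmall)
  choose v hv hvle using hsol
  have hvR p : ‖v p‖ ≤ 2 * C_D * m := (hvle p).trans (by gcongr; exact hym p)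
  have hcont : Continuous v := continuous_of_quadratic_estimate e hC hinv hy.continuous
    hQsmooth.continuous hQ hv hvR (by linarith)
  refine ⟨v, ?_, fun p => ⟨hv p, hvle p⟩⟩
  refine contDiff_of_implicit_eq (F := fun z : P × X => y z.1 + e z.2 + Q z)
    (by fun_prop) hcont hv fun p => ?_
  have hQd : HasFDerivAt Q (fderiv ℝ Q (p, v p)) (p, v p) :=
    (hQsmooth.differentiable (by simp) _).hasFDerivAt
  have hyd : HasFDerivAt y (fderiv ℝ y p) p := (hy.differentiable (by simp) _).hasFDerivAt
  have hFd : HasFDerivAt (fun z : P × X => y z.1 + e z.2 + Q z)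
      (fderiv ℝ y p ∘L .fst ℝ P X + (e : X →L[ℝ] Y) ∘L .snd ℝ P X + fderiv ℝ Q (p, v p))
      (p, v p) :=
    ((hyd.comp (p, v p) hasFDerivAt_fst).add
      (e.hasFDerivAt.comp (p, v p) hasFDerivAt_snd)).add hQd
  have hpart : fderiv ℝ (fun z : P × X => y z.1 + e z.2 + Q z) (p, v p) ∘L .inr ℝ P X =
      (e : X →L[ℝ] Y) + fderiv ℝ Q (p, v p) ∘L .inr ℝ P X := by
    rw [hFd.fderiv]
    ext x
    simp
  rw [hpart]
  refine e.isInvertible_add_of_norm_symm_mul_norm_lt_one ?_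
  have hD : ‖fderiv ℝ Q (p, v p) ∘L .inr ℝ P X‖ ≤ 2 * C * ‖v p‖ :=
    HasFDerivAt.norm_le_of_quadratic_estimate (q := fun x => Q (p, x)) hC (hQ p)
      (hQd.comp (v p) (hasFDerivAt_prodMk_right p (v p)))
  calc ‖(e.symm : Y →L[ℝ] X)‖ * ‖fderiv ℝ Q (p, v p) ∘L .inr ℝ P X‖
      ≤ C_D * (2 * C * (2 * C_D * m)) := by
        gcongr
        exact hD.trans (by gcongr; exact hvR p)
    _ = 4 * C_D ^ 2 * C * m := by ring
    _ < 1 := hsmall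
end

section
/- Fix real numbers α and γ with 0 < α < 1 and γ > 1, and define h(s, r, t) = t − s·t^α·r^γ for s, r, t real with r, t > 0. Then for every s > 0 and all ε, η with 0 < ε < η < s^{1/(1−α)}, there exists r > 0 such that h(s, r, η) = h(s, r, ε); that is, the perturbed fibres through η and through ε intersect. -/
/-- Toy model of the failure of the strong fibration property:
for `h s r t = t - s * t ^ α * r ^ γ` (real powers) with `0 < α < 1 < γ`, for every
`s > 0` and all `0 < ε < η < s ^ (1 / (1 - α))` there is an `r > 0` where the perturbed
fibres through `η` and `ε` intersect: `h s r η = h s r ε`. -/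
theorem stmt_4 (α γ : ℝ) (hα : 0 < α) (hα1 : α < 1) (hγ : 1 < γ)
    (h : ℝ → ℝ → ℝ → ℝ)
    (hdef : ∀ s r t : ℝ, h s r t = t - s * t ^ α * r ^ γ) :
    ∀ s : ℝ, 0 < s → ∀ ε η : ℝ, 0 < ε → ε < η → η < s ^ (1 / (1 - α)) →
      ∃ r : ℝ, 0 < r ∧ h s r η = h s r ε := by
  intro s hs ε η hε hεη _
  have hpow : 0 < η ^ α - ε ^ α := sub_pos.2 (Real.rpow_lt_rpow hε.le hεη hα)
  have hquot : 0 < (η - ε) / (s * (η ^ α - ε ^ α)) :=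
    div_pos (sub_pos.2 hεη) (mul_pos hs hpow)
  refine ⟨((η - ε) / (s * (η ^ α - ε ^ α))) ^ γ⁻¹, Real.rpow_pos_of_pos hquot _, ?_⟩
  rw [hdef, hdef, Real.rpow_inv_rpow hquot.le (by linarith)]
  have hcancel : s * (η ^ α - ε ^ α) * ((η - ε) / (s * (η ^ α - ε ^ α))) = η - ε :=
    mul_div_cancel₀ _ (mul_pos hs hpow).ne'
  linear_combination -hcancel
end

section
/- Let ε ∈ ℂ with ε ≠ 0, and let Q_ε = {(x, y, z) ∈ ℂ³ : x² + y² + z² = ε} be the smooth affine quadric surface. If U ⊆ ℂ³ is an open set containing Q_ε and f : ℂ³ → ℂ is complex differentiable on U and bounded on Q_ε, then f is constant on Q_ε. -/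
/-- A function holomorphic near a set `S` and bounded on `S` is constant along every entire curve
contained in `S`. -/
theorem DifferentiableOn.apply_eq_apply_of_entire_curve {E : Type*} [NormedAddCommGroup E]
    [NormedSpace ℂ E] {f : E → ℂ} {S U : Set E} (hf : DifferentiableOn ℂ f U) (hU : IsOpen U)
    (hSU : S ⊆ U) (hb : ∃ M : ℝ, ∀ p ∈ S, ‖f p‖ ≤ M) {γ : ℂ → E} (hγ : Differentiable ℂ γ)
    (hγS : ∀ t, γ t ∈ S) (s t : ℂ) : f (γ s) = f (γ t) := by
  obtain ⟨M, hM⟩ := hb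
  have hd : Differentiable ℂ (f ∘ γ) := fun t =>
    (hf.differentiableAt (hU.mem_nhds (hSU (hγS t)))).comp t (hγ t)
  refine hd.apply_eq_apply_of_bounded ?_ s t
  refine isBounded_iff_forall_norm_le.2 ⟨M, ?_⟩
  rintro _ ⟨t, rfl⟩
  exact hM _ (hγS t)

/-- The linear coordinates on `ℂ³` in which `x² + y² + z²` becomes `u * v + z²`. -/
noncomputable def isotropicCoord (u v z : ℂ) : ℂ × ℂ × ℂ :=
  ((u + v) / 2, (v - u) * Complex.I / 2, z)

theorem isotropicCoord_quadric (u v z : ℂ) :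
    (isotropicCoord u v z).1 ^ 2 + (isotropicCoord u v z).2.1 ^ 2 +
      (isotropicCoord u v z).2.2 ^ 2 = u * v + z ^ 2 := by
  simp only [isotropicCoord]
  linear_combination (v - u) ^ 2 / 4 * Complex.I_sq

theorem isotropicCoord_surjective (p : ℂ × ℂ × ℂ) : ∃ u v z, isotropicCoord u v z = p := by
  obtain ⟨x, y, z⟩ := p
  refine ⟨x + y * Complex.I, x - y * Complex.I, z, ?_⟩
  simp only [isotropicCoord, Prod.mk.injEq, and_true]
  constructor
  · ring
  · linear_combination -y * Complex.I_sq

/-- A function constant along every entire curve in `{u * v + z² = ε}` is constant there. -/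
theorem eq_base_of_const_on_entire_curves {ε : ℂ} {g : ℂ → ℂ → ℂ → ℂ}
    (hg : ∀ a b c : ℂ → ℂ, Differentiable ℂ a → Differentiable ℂ b → Differentiable ℂ c →
      (∀ t, a t * b t + c t ^ 2 = ε) → ∀ s t, g (a s) (b s) (c s) = g (a t) (b t) (c t))
    {u v z : ℂ} (h : u * v + z ^ 2 = ε) : g u v z = g ε 1 0 := by
  have fix_u {u v z v' z' : ℂ} (hu : u ≠ 0) (h : u * v + z ^ 2 = ε)
      (h' : u * v' + z' ^ 2 = ε) : g u v z = g u v' z' := by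
    have key := hg (fun _ => u) (fun t => (ε - t ^ 2) / u) (fun t => t)
      (by fun_prop) (by fun_prop) (by fun_prop) (fun t => by field_simp; ring) z z'
    have e : (ε - z ^ 2) / u = v := by rw [div_eq_iff hu]; linear_combination -h
    have e' : (ε - z' ^ 2) / u = v' := by rw [div_eq_iff hu]; linear_combination -h'
    simpa only [e, e'] using key
  have fix_v {u v z u' z' : ℂ} (hv : v ≠ 0) (h : u * v + z ^ 2 = ε)
      (h' : u' * v + z' ^ 2 = ε) : g u v z = g u' v z' := by
    have key := hg (fun t => (ε - t ^ 2) / v) (fun _ => v) (fun t => t)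
      (by fun_prop) (by fun_prop) (by fun_prop) (fun t => by field_simp; ring) z z'
    have e : (ε - z ^ 2) / v = u := by rw [div_eq_iff hv]; linear_combination -h
    have e' : (ε - z' ^ 2) / v = u' := by rw [div_eq_iff hv]; linear_combination -h'
    simpa only [e, e'] using key
  by_cases hu : u = 0
  · subst hu
    have key := hg (fun _ => 0) (fun t => t) (fun _ => z)
      (by fun_prop) (by fun_prop) (by fun_prop) (fun t => by linear_combination h) v 1
    exact key.trans (fix_v one_ne_zero (by linear_combination h) (by ring))
  · obtain ⟨w, hw⟩ := IsAlgClosed.exists_eq_mul_self (ε - u)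
    exact (fix_u (v' := 1) (z' := w) hu h (by linear_combination -hw)).trans
      (fix_v one_ne_zero (by linear_combination -hw) (by ring))

/-- Liouville theorem for the smooth affine quadric
`Q_ε = {(x,y,z) ∈ ℂ³ : x² + y² + z² = ε}`, `ε ≠ 0`: any function holomorphic on an open
neighbourhood of `Q_ε` and bounded on `Q_ε` is constant on `Q_ε`. -/
theorem stmt_6 (ε : ℂ) (hε : ε ≠ 0)
    (Qε : Set (ℂ × ℂ × ℂ))
    (hQε : Qε = {p : ℂ × ℂ × ℂ | p.1 ^ 2 + p.2.1 ^ 2 + p.2.2 ^ 2 = ε})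
    (U : Set (ℂ × ℂ × ℂ)) (hU : IsOpen U) (hQU : Qε ⊆ U)
    (f : ℂ × ℂ × ℂ → ℂ) (hf : DifferentiableOn ℂ f U)
    (hbdd : ∃ M : ℝ, ∀ p ∈ Qε, ‖f p‖ ≤ M) :
    ∀ p ∈ Qε, ∀ q ∈ Qε, f p = f q := by
  subst hQε
  have base : ∀ p ∈ {p : ℂ × ℂ × ℂ | p.1 ^ 2 + p.2.1 ^ 2 + p.2.2 ^ 2 = ε},
      f p = f (isotropicCoord ε 1 0) := by
    intro p hp
    obtain ⟨u, v, z, rfl⟩ := isotropicCoord_surjective p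
    refine eq_base_of_const_on_entire_curves (g := fun u v z => f (isotropicCoord u v z)) ?_
      ((isotropicCoord_quadric u v z).symm.trans hp)
    intro a b c ha hb hc habc
    refine hf.apply_eq_apply_of_entire_curve hU hQU hbdd
      (γ := fun t => isotropicCoord (a t) (b t) (c t)) ?_
      fun t => (isotropicCoord_quadric _ _ _).trans (habc t)
    unfold isotropicCoord
    fun_prop
  intro p hp q hq
  rw [base p hp, base q hq]
end

section
/- The set S = {(a, b, c, w) ∈ ℂ⁴ : 4a³ + 1 = 0, 4b³ + 10 = 0, 4c³ + 100 = 0, a⁴ + b⁴ + c⁴ + 1 + w⁴ + (a + 10b + 100c) = 0} is finite and has exactly 108 = 3³·4 elements. -/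
/-- The set of singular points of fibres of the anticanonical pencil of the quartic
`P = x₀⁴ + x₁⁴ + x₂⁴ + x₃⁴ + x₄⁴ + x₃³(x₀ + 10x₁ + 100x₂)` in the chart `x₃ = 1`. -/
def singSet : Set (ℂ × ℂ × ℂ × ℂ) :=
  {p | 4 * p.1 ^ 3 + 1 = 0 ∧ 4 * p.2.1 ^ 3 + 10 = 0 ∧ 4 * p.2.2.1 ^ 3 + 100 = 0 ∧
    p.1 ^ 4 + p.2.1 ^ 4 + p.2.2.1 ^ 4 + 1 + p.2.2.2 ^ 4 +
      (p.1 + 10 * p.2.1 + 100 * p.2.2.1) = 0}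

/-- A nonzero complex number has exactly `n` distinct `n`-th roots. -/
theorem Complex.card_toFinset_nthRoots {n : ℕ} (hn : n ≠ 0) {z : ℂ} (hz : z ≠ 0) :
    (Polynomial.nthRoots n z).toFinset.card = n := by
  have hζ := Complex.isPrimitiveRoot_exp n hn
  rw [Multiset.toFinset_card_of_nodup (hζ.nthRoots_nodup hz), hζ.card_nthRoots,
    if_pos (IsAlgClosed.exists_pow_nat_eq z (Nat.pos_of_ne_zero hn))]

/-- The value of `w ^ 4` on the singular set never vanishes, since the term in `c` dominates. -/
theorem one_add_linear_ne_zero {a b c : ℂ} (ha : a ^ 3 = -1 / 4) (hb : b ^ 3 = -5 / 2)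
    (hc : c ^ 3 = -25) : -(1 + 3 / 4 * (a + 10 * b + 100 * c)) ≠ 0 := by
  intro h
  have ha' : ‖a‖ ^ 3 = 1 / 4 := by rw [← norm_pow, ha]; norm_num
  have hb' : ‖b‖ ^ 3 = 5 / 2 := by rw [← norm_pow, hb]; norm_num
  have hc' : ‖c‖ ^ 3 = 25 := by rw [← norm_pow, hc]; norm_num
  have ha₁ : ‖a‖ ≤ 1 := le_of_pow_le_pow_left₀ three_ne_zero (by norm_num) (by rw [ha']; norm_num)
  have hb₁ : ‖b‖ ≤ 2 := le_of_pow_le_pow_left₀ three_ne_zero (by norm_num) (by rw [hb']; norm_num)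
  have hc₁ : 2 ≤ ‖c‖ :=
    le_of_pow_le_pow_left₀ three_ne_zero (norm_nonneg c) (by rw [hc']; norm_num)
  have key : 100 * c = -(4 / 3 + a + 10 * b) := by linear_combination (-4 / 3) * h
  have hnorm : 100 * ‖c‖ ≤ 4 / 3 + ‖a‖ + 10 * ‖b‖ := by
    calc 100 * ‖c‖ = ‖100 * c‖ := by simp
      _ = ‖4 / 3 + a + 10 * b‖ := by rw [key, norm_neg]
      _ ≤ ‖(4 / 3 : ℂ)‖ + ‖a‖ + ‖10 * b‖ := norm_add₃_le
      _ = 4 / 3 + ‖a‖ + 10 * ‖b‖ := by simp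
  linarith

/-- Membership in the singular set, with each coordinate given by an explicit root extraction. -/
theorem mem_singSet_iff {a b c w : ℂ} :
    (a, b, c, w) ∈ singSet ↔ a ^ 3 = -1 / 4 ∧ b ^ 3 = -5 / 2 ∧ c ^ 3 = -25 ∧
      w ^ 4 = -(1 + 3 / 4 * (a + 10 * b + 100 * c)) := by
  simp only [singSet, Set.mem_ofPred_eq]
  constructor
  · rintro ⟨ha, hb, hc, hw⟩
    refine ⟨?_, ?_, ?_, ?_⟩
    · linear_combination ha / 4
    · linear_combination hb / 4
    · linear_combination hc / 4
    · linear_combination hw - a / 4 * ha - b / 4 * hb - c / 4 * hc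
  · rintro ⟨ha, hb, hc, hw⟩
    refine ⟨?_, ?_, ?_, ?_⟩
    · linear_combination 4 * ha
    · linear_combination 4 * hb
    · linear_combination 4 * hc
    · linear_combination hw + a * ha + b * hb + c * hc

/-- The singular set `S` is finite with exactly `108 = 3³ * 4`
elements: the Bézout bound is attained. -/
theorem stmt_10 : singSet.Finite ∧ singSet.ncard = 108 := by
  classical
  let base : Finset (ℂ × ℂ × ℂ) := (Polynomial.nthRoots 3 (-1 / 4 : ℂ)).toFinset ×ˢ
    (Polynomial.nthRoots 3 (-5 / 2 : ℂ)).toFinset ×ˢ (Polynomial.nthRoots 3 (-25 : ℂ)).toFinset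
  let fiber (q : ℂ × ℂ × ℂ) : Finset ℂ :=
    (Polynomial.nthRoots 4 (-(1 + 3 / 4 * (q.1 + 10 * q.2.1 + 100 * q.2.2)))).toFinset
  let e (s : Σ _ : ℂ × ℂ × ℂ, ℂ) : ℂ × ℂ × ℂ × ℂ := (s.1.1, s.1.2.1, s.1.2.2, s.2)
  have he : Function.Injective e := by
    rintro ⟨⟨a, b, c⟩, w⟩ ⟨⟨a', b', c'⟩, w'⟩ h
    simp only [e, Prod.mk.injEq] at h
    obtain ⟨rfl, rfl, rfl, rfl⟩ := h
    rfl
  have hmem_base (a b c : ℂ) :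
      (a, b, c) ∈ base ↔ a ^ 3 = -1 / 4 ∧ b ^ 3 = -5 / 2 ∧ c ^ 3 = -25 := by
    simp only [base, Finset.mem_product, Multiset.mem_toFinset, Polynomial.mem_nthRoots three_pos]
  have hS : singSet = ((base.sigma fiber).image e : Finset (ℂ × ℂ × ℂ × ℂ)) := by
    ext ⟨a, b, c, w⟩
    rw [Finset.mem_coe, show (a, b, c, w) = e ⟨(a, b, c), w⟩ from rfl,
      he.mem_finset_image, Finset.mem_sigma, hmem_base, Multiset.mem_toFinset,
      Polynomial.mem_nthRoots four_pos]
    exact mem_singSet_iff.trans (by tauto)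
  have hfiber : ∀ q ∈ base, (fiber q).card = 4 := by
    rintro ⟨a, b, c⟩ hq
    obtain ⟨ha, hb, hc⟩ := (hmem_base a b c).1 hq
    exact Complex.card_toFinset_nthRoots four_ne_zero (one_add_linear_ne_zero ha hb hc)
  have hbase : base.card = 27 := by
    simp only [base, Finset.card_product]
    rw [Complex.card_toFinset_nthRoots three_ne_zero (by norm_num),
      Complex.card_toFinset_nthRoots three_ne_zero (by norm_num),
      Complex.card_toFinset_nthRoots three_ne_zero (by norm_num)]
  rw [hS]
  refine ⟨Finset.finite_toSet _, ?_⟩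
  rw [Set.ncard_coe_finset, Finset.card_image_of_injective _ he, Finset.card_sigma,
    Finset.sum_const_nat hfiber, hbase]
end

section
/- If (a, b, c, w) and (a′, b′, c′, w′) are two elements of S with w = w′, then (a, b, c, w) = (a′, b′, c′, w′). In other words, the coordinate map (a,b,c,w) ↦ w is injective on S, so no two singular points of the pencil lie in the same fibre. -/
/-- Distinct complex numbers with the same cube are at least as far apart as their modulus. -/
theorem le_norm_sub_of_pow_three_eq {x y : ℂ} {r : ℝ} (hr : 0 ≤ r) (hx : r ≤ ‖x‖) (hy : r ≤ ‖y‖)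
    (h : x ^ 3 = y ^ 3) (hne : x ≠ y) : r ≤ ‖x - y‖ := by
  have hsum : x ^ 2 + x * y + y ^ 2 = 0 := by
    refine (mul_eq_zero.mp ?_).resolve_left (sub_ne_zero.mpr hne)
    linear_combination h
  have hsq : (x - y) ^ 2 = -3 * (x * y) := by linear_combination hsum
  have hnorm : ‖x - y‖ ^ 2 = 3 * (‖x‖ * ‖y‖) := by
    rw [← norm_pow, hsq]
    simp
  nlinarith [norm_nonneg (x - y), mul_le_mul hx hy hr (norm_nonneg x)]

/-- The modulus of a root of `4 z³ + k`. -/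
theorem norm_pow_three_of_four_mul_add {z : ℂ} {k : ℝ} (hk : 0 ≤ k) (h : 4 * z ^ 3 + k = 0) :
    ‖z‖ ^ 3 = k / 4 := by
  have hz : z ^ 3 = ((-(k / 4) : ℝ) : ℂ) := by
    push_cast
    linear_combination h / 4
  rw [← norm_pow, hz, Complex.norm_real, norm_neg, Real.norm_of_nonneg (by positivity)]

/-- The last coordinate `w` is injective on `S`: no two singular points
of the pencil lie in the same fibre. -/
theorem stmt_11 :
    ∀ p ∈ singSet, ∀ q ∈ singSet, p.2.2.2 = q.2.2.2 → p = q := by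
  rintro ⟨a, b, c, w⟩ ⟨ha, hb, hc, hw⟩ ⟨a', b', c', w'⟩ ⟨ha', hb', hc', hw'⟩ hww
  dsimp only at *
  subst hww
  have hlin : a + 10 * b + 100 * c = a' + 10 * b' + 100 * c' := by
    linear_combination (4 / 3) * (hw - hw') - (a * ha - a' * ha') / 3
      - (b * hb - b' * hb') / 3 - (c * hc - c' * hc') / 3
  have norm_a_le : ∀ z : ℂ, 4 * z ^ 3 + 1 = 0 → ‖z‖ ≤ 1 := fun z hz =>
    le_of_pow_le_pow_left₀ three_ne_zero (by norm_num)
      (by rw [norm_pow_three_of_four_mul_add (k := 1) (by norm_num) (by simpa using hz)]; norm_num)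
  have norm_b_le : ∀ z : ℂ, 4 * z ^ 3 + 10 = 0 → ‖z‖ ≤ 2 := fun z hz =>
    le_of_pow_le_pow_left₀ three_ne_zero (by norm_num)
      (by rw [norm_pow_three_of_four_mul_add (k := 10) (by norm_num) (by simpa using hz)]; norm_num)
  have le_norm_b : ∀ z : ℂ, 4 * z ^ 3 + 10 = 0 → 1 ≤ ‖z‖ := fun z hz =>
    le_of_pow_le_pow_left₀ three_ne_zero (norm_nonneg z)
      (by rw [norm_pow_three_of_four_mul_add (k := 10) (by norm_num) (by simpa using hz)]; norm_num)
  have le_norm_c : ∀ z : ℂ, 4 * z ^ 3 + 100 = 0 → 2 ≤ ‖z‖ := fun z hz =>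
    le_of_pow_le_pow_left₀ three_ne_zero (norm_nonneg z)
      (by rw [norm_pow_three_of_four_mul_add (k := 100) (by norm_num) (by simpa using hz)]; norm_num)
  have hA : ‖a' - a‖ ≤ 2 := by
    linarith [norm_sub_le a' a, norm_a_le a ha, norm_a_le a' ha']
  have hB : ‖b' - b‖ ≤ 4 := by
    linarith [norm_sub_le b' b, norm_b_le b hb, norm_b_le b' hb']
  have hcc : c = c' := by
    by_contra hne
    have hsep := le_norm_sub_of_pow_three_eq (by norm_num) (le_norm_c c hc) (le_norm_c c' hc')
      (by linear_combination (hc - hc') / 4) hne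
    have heq : 100 * (c - c') = (a' - a) + 10 * (b' - b) := by linear_combination hlin
    have hle := norm_add_le (a' - a) (10 * (b' - b))
    rw [← heq, norm_mul, norm_mul, Complex.norm_ofNat, Complex.norm_ofNat] at hle
    linarith
  subst hcc
  have hbb : b = b' := by
    by_contra hne
    have hsep := le_norm_sub_of_pow_three_eq (by norm_num) (le_norm_b b hb) (le_norm_b b' hb')
      (by linear_combination (hb - hb') / 4) hne
    have heq : 10 * (b - b') = a' - a := by linear_combination hlin
    rw [← heq, norm_mul, Complex.norm_ofNat] at hA
    linarith
  subst hbb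
  have haa : a = a' := by linear_combination hlin
  rw [haa]
end

section
/- Define G : ℂ⁴ → ℂ⁴ by G(a, b, c, w) = (a⁴ + b⁴ + c⁴ + 1 + w⁴ + (a + 10b + 100c), 4a³ + 1, 4b³ + 10, 4c³ + 100). Then for every point p ∈ S, the Fréchet derivative of G at p is a bijective (complex) linear map ℂ⁴ → ℂ⁴. In particular every point of S is a solution of multiplicity one of the system defining it. -/
/-- The defining map of the system: fibre equation together with the three derivative
equations. -/
def Gmap : ℂ × ℂ × ℂ × ℂ → ℂ × ℂ × ℂ × ℂ :=
  fun p =>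
    (p.1 ^ 4 + p.2.1 ^ 4 + p.2.2.1 ^ 4 + 1 + p.2.2.2 ^ 4 +
        (p.1 + 10 * p.2.1 + 100 * p.2.2.1),
      4 * p.1 ^ 3 + 1, 4 * p.2.1 ^ 3 + 10, 4 * p.2.2.1 ^ 3 + 100)

theorem fderiv_Gmap_apply (p v : ℂ × ℂ × ℂ × ℂ) :
    fderiv ℂ Gmap p v =
      ((4 * p.1 ^ 3 + 1) * v.1 + (4 * p.2.1 ^ 3 + 10) * v.2.1 +
          (4 * p.2.2.1 ^ 3 + 100) * v.2.2.1 + 4 * p.2.2.2 ^ 3 * v.2.2.2,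
        12 * p.1 ^ 2 * v.1, 12 * p.2.1 ^ 2 * v.2.1, 12 * p.2.2.1 ^ 2 * v.2.2.1) := by
  have ha := hasFDerivAt_fst (𝕜 := ℂ) (p := p)
  have hr := hasFDerivAt_snd (𝕜 := ℂ) (p := p)
  have hb := hr.fst
  have hc := hr.snd.fst
  have hw := hr.snd.snd
  have h := (((((((ha.pow 4).add (hb.pow 4)).add (hc.pow 4)).add_const 1).add (hw.pow 4)).add
    ((ha.add (hb.const_mul 10)).add (hc.const_mul 100)))).prodMk
    ((((ha.pow 3).const_mul 4).add_const 1).prodMk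
      ((((hb.pow 3).const_mul 4).add_const 10).prodMk
        (((hc.pow 3).const_mul 4).add_const 100)))
  have h' : fderiv ℂ Gmap p = _ := HasFDerivAt.fderiv h
  rw [h']
  ext <;> simp <;> ring

/-- On `singSet`, vanishing of `w` would force `3 * (a + 10 * b + 100 * c) = -4`, which is
impossible because the term in `c` dominates in absolute value. -/
theorem ne_zero_of_mem_singSet {p : ℂ × ℂ × ℂ × ℂ} (hp : p ∈ singSet) : p.2.2.2 ≠ 0 := by
  obtain ⟨a, b, c, w⟩ := p
  obtain ⟨ha, hb, hc, h⟩ := hp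
  dsimp only at *
  rintro rfl
  have key : 300 * c = -(4 + 3 * a + 30 * b) := by
    linear_combination 4 * h - a * ha - b * hb - c * hc
  have norm_a : ‖a‖ ^ 3 = 1 / 4 := by
    rw [← norm_pow, show a ^ 3 = -(1 / 4) by linear_combination ha / 4]
    norm_num
  have norm_b : ‖b‖ ^ 3 = 5 / 2 := by
    rw [← norm_pow, show b ^ 3 = -(5 / 2) by linear_combination hb / 4]
    norm_num
  have norm_c : ‖c‖ ^ 3 = 25 := by
    rw [← norm_pow, show c ^ 3 = -25 by linear_combination hc / 4]
    norm_num
  have a_le : ‖a‖ ≤ 1 := le_of_pow_le_pow_left₀ three_ne_zero (by norm_num)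
    (by rw [norm_a]; norm_num)
  have b_le : ‖b‖ ≤ 2 := le_of_pow_le_pow_left₀ three_ne_zero (by norm_num)
    (by rw [norm_b]; norm_num)
  have le_c : 2 ≤ ‖c‖ :=
    le_of_pow_le_pow_left₀ three_ne_zero (norm_nonneg c) (by rw [norm_c]; norm_num)
  have bound : 300 * ‖c‖ ≤ 4 + 3 * ‖a‖ + 30 * ‖b‖ := by
    calc 300 * ‖c‖ = ‖4 + 3 * a + 30 * b‖ := by rw [← norm_neg (4 + _ + _), ← key]; simp
      _ ≤ ‖(4 : ℂ)‖ + ‖3 * a‖ + ‖30 * b‖ := norm_add₃_le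
      _ = 4 + 3 * ‖a‖ + 30 * ‖b‖ := by simp
  linarith

/-- At every point of `S` the (complex) Fréchet derivative of `G` is a
bijective linear map `ℂ⁴ → ℂ⁴`: every solution of the system has multiplicity one. -/
theorem stmt_15 : ∀ p ∈ singSet, Function.Bijective (fderiv ℂ Gmap p) := by
  intro p hp
  have hw := ne_zero_of_mem_singSet hp
  obtain ⟨ha, hb, hc, -⟩ := hp
  have a_ne : p.1 ≠ 0 := by
    intro h
    norm_num [h] at ha
  have b_ne : p.2.1 ≠ 0 := by
    intro h
    norm_num [h] at hb
  have c_ne : p.2.2.1 ≠ 0 := by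
    intro h
    norm_num [h] at hc
  have inj : Function.Injective (fderiv ℂ Gmap p) := by
    rw [injective_iff_map_eq_zero]
    rintro ⟨x, y, z, t⟩ hv
    rw [fderiv_Gmap_apply] at hv
    simp_all [Prod.ext_iff]
  exact ⟨inj, LinearMap.surjective_of_injective (f := (fderiv ℂ Gmap p).toLinearMap) inj⟩
end
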